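/- The number of DFT_2-based bit-index-permuted fast WHT algorithms, i.e. sequences P = (P_0,...,P_n) of permutation matrices in GL_n(F_2) with W(P) = H_n, equals n·((n−1)!)^{n+1}. -/

import Mathlib

open Matrix

/-- Binary representation of `i` as a vector in `F_2^n`, most significant bit first. -/
def bits (n : ℕ) (i : Fin (2 ^ n)) : Fin n → ZMod 2 :=
  fun k => if Nat.testBit i.val (n - 1 - k.val) then 1 else 0

/-- The vector `1_b = (0,...,0,1)ᵀ`. -/
def oneb (n : ℕ) : Fin n → ZMod 2 := fun k => if k.val = n - 1 then 1 else 0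

/-- Permutation matrix `P(Q)` of the linear permutation `π(Q)`:
entry `(j, i)` is `1` iff `j_b = Q i_b`. -/
def permMat (n : ℕ) (Q : Matrix (Fin n) (Fin n) (ZMod 2)) :
    Matrix (Fin (2 ^ n)) (Fin (2 ^ n)) ℤ :=
  Matrix.of fun j i => if bits n j = Q.mulVec (bits n i) then 1 else 0

/-- The array of butterflies `I_{2^{n-1}} ⊗ DFT_2`. -/
def butterflies (n : ℕ) : Matrix (Fin (2 ^ n)) (Fin (2 ^ n)) ℤ :=
  Matrix.of fun j i =>
    if j.val / 2 = i.val / 2 then (if j.val % 2 = 1 ∧ i.val % 2 = 1 then -1 else 1) else 0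

/-- `W(P) = P(P₀)·(I ⊗ DFT₂)·P(P₁) ⋯ (I ⊗ DFT₂)·P(Pₙ)`. -/
def W (n : ℕ) (P : ℕ → Matrix (Fin n) (Fin n) (ZMod 2)) :
    Matrix (Fin (2 ^ n)) (Fin (2 ^ n)) ℤ :=
  permMat n (P 0) * (List.ofFn fun k : Fin n => butterflies n * permMat n (P (k.val + 1))).prod

/-- `P_{i:j} = P_i P_{i+1} ⋯ P_j` (identity if `j < i`). -/
def Pseg {n : ℕ} (P : ℕ → Matrix (Fin n) (Fin n) (ZMod 2)) (i j : ℕ) :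
    Matrix (Fin n) (Fin n) (ZMod 2) :=
  ((List.range (j + 1 - i)).map fun k => P (i + k)).prod

/-- The spreading matrix `X = (P_{0:n-1}1_b | P_{0:n-2}1_b | ⋯ | P_0 1_b)`. -/
def spread (n : ℕ) (P : ℕ → Matrix (Fin n) (Fin n) (ZMod 2)) :
    Matrix (Fin n) (Fin n) (ZMod 2) :=
  Matrix.of fun r c => (Pseg P 0 (n - 1 - c.val)).mulVec (oneb n) r

/-- The matrix whose rows are `(P_{0:n-1}^{-T}1_b)ᵀ, ..., (P_0^{-T}1_b)ᵀ`. -/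
noncomputable def spreadInvRows (n : ℕ) (P : ℕ → Matrix (Fin n) (Fin n) (ZMod 2)) :
    Matrix (Fin n) (Fin n) (ZMod 2) :=
  Matrix.of fun r c => (Pseg P 0 (n - 1 - r.val))⁻¹.transpose.mulVec (oneb n) c

/-- The Hadamard matrix `H_n` with entries `(-1)^{⟨i_b, j_b⟩}`. -/
def hadamardH (n : ℕ) : Matrix (Fin (2 ^ n)) (Fin (2 ^ n)) ℤ :=
  Matrix.of fun i j => (-1) ^ (∑ k, bits n i k * bits n j k).val

/-- The cyclic bit-rotation matrix `C_n`: ones on the superdiagonal and in the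
bottom-left corner. -/
def Cmat (n : ℕ) : Matrix (Fin n) (Fin n) (ZMod 2) :=
  Matrix.of fun k l => if l.val = k.val + 1 ∨ (k.val = n - 1 ∧ l.val = 0) then 1 else 0

/-- `Q` is a permutation matrix. -/
def IsPermMat {n : ℕ} (Q : Matrix (Fin n) (Fin n) (ZMod 2)) : Prop :=
  ∃ σ : Equiv.Perm (Fin n), ∀ i j, Q i j = if i = σ j then 1 else 0

section BitIndex

/-- The permutation matrix of `σ` over `F_2`. -/
def toMat {n : ℕ} (σ : Equiv.Perm (Fin n)) : Matrix (Fin n) (Fin n) (ZMod 2) :=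
  Matrix.of fun i j => if i = σ j then 1 else 0

/-- The sign `(-1)^a` of a bit. -/
def bitSign (a : ZMod 2) : ℤ := (-1) ^ a.val

/-- The action of `σ` on functions on bit vectors, as a matrix. -/
def bitPerm {n : ℕ} (σ : Equiv.Perm (Fin n)) :
    Matrix (Fin n → ZMod 2) (Fin n → ZMod 2) ℤ :=
  Matrix.of fun y x => if y = x ∘ σ.symm then 1 else 0

/-- The butterfly acting on bit `p`. -/
def bitButterfly {n : ℕ} (p : Fin n) : Matrix (Fin n → ZMod 2) (Fin n → ZMod 2) ℤ :=
  Matrix.of fun y x => if ∀ k, k ≠ p → y k = x k then bitSign (y p * x p) else 0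

theorem bitSign_add (a b : ZMod 2) : bitSign (a + b) = bitSign a * bitSign b := by
  revert a b; decide

theorem bitSign_injective : Function.Injective bitSign := by
  unfold Function.Injective; decide

theorem bitSign_ne_zero (a : ZMod 2) : bitSign a ≠ 0 := by
  revert a; decide

theorem bitSign_sum {ι : Type*} (s : Finset ι) (f : ι → ZMod 2) :
    bitSign (∑ k ∈ s, f k) = ∏ k ∈ s, bitSign (f k) := by
  classical
  induction s using Finset.induction_on with
  | empty => simp [bitSign]
  | insert a s ha ih => rw [Finset.sum_insert ha, Finset.prod_insert ha, bitSign_add, ih]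

theorem toMat_mulVec {n : ℕ} (σ : Equiv.Perm (Fin n)) (v : Fin n → ZMod 2) :
    (toMat σ).mulVec v = v ∘ σ.symm := by
  ext i
  simp [toMat, Matrix.mulVec, dotProduct, ← Equiv.symm_apply_eq]

theorem toMat_injective {n : ℕ} :
    Function.Injective (toMat : Equiv.Perm (Fin n) → _) := by
  intro σ τ h
  ext j : 1
  have := congrFun (congrFun h (σ j)) j
  by_contra hne
  simp [toMat, hne] at this

theorem bits_injective (n : ℕ) : Function.Injective (bits n) := by
  intro i j h
  apply Fin.ext
  apply Nat.eq_of_testBit_eq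
  intro t
  by_cases ht : t < n
  · have := congrFun h ⟨n - 1 - t, by omega⟩
    have e : n - 1 - (n - 1 - t) = t := by omega
    simp only [bits, e] at this
    cases h1 : i.val.testBit t <;> cases h2 : j.val.testBit t <;> simp_all
  · have hp : 2 ^ n ≤ 2 ^ t := Nat.pow_le_pow_right (by norm_num) (by omega)
    rw [Nat.testBit_lt_two_pow (i.isLt.trans_le hp), Nat.testBit_lt_two_pow (j.isLt.trans_le hp)]

/-- Indices below `2 ^ n` correspond to bit vectors of length `n`. -/
noncomputable def bitsEquiv (n : ℕ) : Fin (2 ^ n) ≃ (Fin n → ZMod 2) :=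
  Equiv.ofBijective (bits n)
    ((Fintype.bijective_iff_injective_and_card _).2 ⟨bits_injective n, by simp⟩)

theorem bitsEquiv_apply {n : ℕ} (i : Fin (2 ^ n)) : bitsEquiv n i = bits n i := rfl

theorem permMat_toMat {n : ℕ} (σ : Equiv.Perm (Fin n)) :
    permMat n (toMat σ) = reindexAlgEquiv ℤ ℤ (bitsEquiv n).symm (bitPerm σ) := by
  ext j i
  simp [permMat, toMat_mulVec, bitPerm, bitsEquiv_apply]

theorem div_two_eq_iff_bits {m : ℕ} (i j : Fin (2 ^ (m + 1))) :
    j.val / 2 = i.val / 2 ↔ ∀ k, k ≠ Fin.last m → bits (m + 1) j k = bits (m + 1) i k := by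
  constructor
  · intro h k hk
    have hk' : k.val ≠ m := fun h' => hk (Fin.ext h')
    have e : m + 1 - 1 - k.val = (m - 1 - k.val) + 1 := by omega
    simp only [bits, e, Nat.testBit_add_one, h]
  · intro h
    apply Nat.eq_of_testBit_eq
    intro t
    rw [← Nat.testBit_add_one, ← Nat.testBit_add_one]
    by_cases ht : t + 1 < m + 1
    · have := h ⟨m - 1 - t, by omega⟩ (fun h' => by
        have := congrArg Fin.val h'
        simp only [Fin.val_last] at this
        omega)
      have e : m + 1 - 1 - (m - 1 - t) = t + 1 := by omega
      simp only [bits, e] at this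
      cases h1 : i.val.testBit (t + 1) <;> cases h2 : j.val.testBit (t + 1) <;> simp_all
    · have hp : 2 ^ (m + 1) ≤ 2 ^ (t + 1) := Nat.pow_le_pow_right (by norm_num) (by omega)
      rw [Nat.testBit_lt_two_pow (i.isLt.trans_le hp),
        Nat.testBit_lt_two_pow (j.isLt.trans_le hp)]

theorem butterflies_eq (m : ℕ) :
    butterflies (m + 1) =
      reindexAlgEquiv ℤ ℤ (bitsEquiv (m + 1)).symm (bitButterfly (Fin.last m)) := by
  ext j i
  have key : (if j.val % 2 = 1 ∧ i.val % 2 = 1 then (-1 : ℤ) else 1) =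
      bitSign (bits (m + 1) j (Fin.last m) * bits (m + 1) i (Fin.last m)) := by
    have hb (a : Fin (2 ^ (m + 1))) :
        bits (m + 1) a (Fin.last m) = if a.val % 2 = 1 then 1 else 0 := by
      simp [bits, Nat.testBit_zero]
    rw [hb, hb]
    by_cases h1 : j.val % 2 = 1 <;> by_cases h2 : i.val % 2 = 1 <;>
      simp [h1, h2] <;> decide
  simp only [butterflies, bitButterfly, key, div_two_eq_iff_bits, coe_reindexAlgEquiv,
    reindex_apply, Equiv.symm_symm, submatrix_apply, bitsEquiv_apply, Matrix.of_apply]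

theorem hadamardH_eq (n : ℕ) :
    hadamardH n = reindexAlgEquiv ℤ ℤ (bitsEquiv n).symm
      (Matrix.of fun y x => bitSign (∑ k, y k * x k)) := by
  ext j i
  simp [hadamardH, bitSign, bitsEquiv_apply]

theorem mul_bitPerm_apply {n : ℕ} (M : Matrix (Fin n → ZMod 2) (Fin n → ZMod 2) ℤ)
    (σ : Equiv.Perm (Fin n)) (y x : Fin n → ZMod 2) :
    (M * bitPerm σ) y x = M y (x ∘ σ.symm) := by
  simp [Matrix.mul_apply, bitPerm]

theorem bitPerm_mul_apply {n : ℕ} (M : Matrix (Fin n → ZMod 2) (Fin n → ZMod 2) ℤ)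
    (σ : Equiv.Perm (Fin n)) (y x : Fin n → ZMod 2) :
    (bitPerm σ * M) y x = M (y ∘ σ) x := by
  have h (z : Fin n → ZMod 2) : y = z ∘ σ.symm ↔ y ∘ σ = z := by
    rw [eq_comm, Equiv.comp_symm_eq, eq_comm]
  simp [Matrix.mul_apply, bitPerm, h]

theorem bitPerm_mul {n : ℕ} (σ τ : Equiv.Perm (Fin n)) :
    bitPerm (σ * τ) = bitPerm σ * bitPerm τ := by
  ext y x
  rw [mul_bitPerm_apply]
  rfl

theorem bitPerm_mul_bitButterfly {n : ℕ} (σ : Equiv.Perm (Fin n)) (p : Fin n) :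
    bitPerm σ * bitButterfly p = bitButterfly (σ p) * bitPerm σ := by
  ext y x
  rw [mul_bitPerm_apply, bitPerm_mul_apply]
  simp only [bitButterfly, Matrix.of_apply, Function.comp_apply, Equiv.symm_apply_apply]
  congr 1
  rw [← σ.forall_congr_right (q := fun k => k ≠ σ p → y k = x (σ.symm k))]
  simp

/-- The successive quotients of a sequence of permutations. -/
def stepPerm {n : ℕ} (τ : ℕ → Equiv.Perm (Fin n)) : ℕ → Equiv.Perm (Fin n)
  | 0 => τ 0
  | k + 1 => (τ k)⁻¹ * τ (k + 1)

theorem bitPerm_mul_prod_butterflies {n : ℕ} (p : Fin n) (τ : ℕ → Equiv.Perm (Fin n)) (r : ℕ) :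
    bitPerm (stepPerm τ 0) *
        (List.ofFn fun k : Fin r => bitButterfly p * bitPerm (stepPerm τ (k.val + 1))).prod =
      ((List.ofFn fun k : Fin r => τ k.val p).map bitButterfly).prod * bitPerm (τ r) := by
  induction r with
  | zero => simp [stepPerm]
  | succ r ih =>
    simp only [List.ofFn_succ', List.concat_eq_append, List.prod_append, List.map_append,
      List.prod_singleton, List.map_cons, List.map_nil, Fin.val_castSucc, Fin.val_last]
    rw [← mul_assoc, ih]
    simp only [mul_assoc]
    congr 1
    rw [← mul_assoc, bitPerm_mul_bitButterfly, mul_assoc, ← bitPerm_mul, stepPerm,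
      mul_inv_cancel_left]

theorem W_stepPerm (m : ℕ) (τ : ℕ → Equiv.Perm (Fin (m + 1))) :
    W (m + 1) (fun t => toMat (stepPerm τ t)) =
      reindexAlgEquiv ℤ ℤ (bitsEquiv (m + 1)).symm
        (((List.ofFn fun k : Fin (m + 1) => τ k.val (Fin.last m)).map bitButterfly).prod *
          bitPerm (τ (m + 1))) := by
  rw [← bitPerm_mul_prod_butterflies, map_mul, map_list_prod, List.map_ofFn, W]
  simp only [permMat_toMat, butterflies_eq, Function.comp_def, map_mul]

theorem bitButterfly_mul_apply {n : ℕ} (p : Fin n)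
    (M : Matrix (Fin n → ZMod 2) (Fin n → ZMod 2) ℤ) (y x : Fin n → ZMod 2)
    (h : ∀ z, M z x ≠ 0 → z p = x p) :
    (bitButterfly p * M) y x = bitSign (y p * x p) * M (Function.update y p (x p)) x := by
  rw [Matrix.mul_apply, Finset.sum_eq_single (Function.update y p (x p))]
  · congr 1
    simp +contextual [bitButterfly]
  · intro z _ hz
    by_contra hne
    apply hz
    have h1 : ∀ k, k ≠ p → y k = z k := by
      by_contra hc
      exact hne (by simp only [bitButterfly, Matrix.of_apply, if_neg hc, zero_mul])
    ext k
    by_cases hk : k = p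
    · subst hk
      simpa using h z (right_ne_zero_of_mul hne)
    · simp [hk, h1 k hk]
  · simp

theorem prod_bitButterfly_eq_zero {n : ℕ} (L : List (Fin n)) (q : Fin n) (hq : q ∉ L)
    (y x : Fin n → ZMod 2) (h : y q ≠ x q) : (L.map bitButterfly).prod y x = 0 := by
  induction L generalizing y with
  | nil =>
    have : y ≠ x := fun h' => h (congrFun h' q)
    simp [this]
  | cons p L ih =>
    simp only [List.mem_cons, not_or] at hq
    rw [List.map_cons, List.prod_cons, Matrix.mul_apply]
    refine Finset.sum_eq_zero fun z _ => ?_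
    by_cases hz : y q = z q
    · rw [ih hq.2 z (hz ▸ h), mul_zero]
    · have : ¬ ∀ k, k ≠ p → y k = z k := fun h' => hz (h' q hq.1)
      simp only [bitButterfly, Matrix.of_apply, if_neg this, zero_mul]

theorem prod_bitButterfly_apply {n : ℕ} (L : List (Fin n)) (hL : L.Nodup)
    (y x : Fin n → ZMod 2) (h : ∀ k, k ∉ L → y k = x k) :
    (L.map bitButterfly).prod y x = (L.map fun p => bitSign (y p * x p)).prod := by
  induction L generalizing y with
  | nil =>
    have : y = x := funext fun k => h k (by simp)
    simp [this]
  | cons p L ih =>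
    rw [List.nodup_cons] at hL
    rw [List.map_cons, List.prod_cons, bitButterfly_mul_apply, ih hL.2, List.map_cons,
      List.prod_cons]
    · congr 2
      refine List.map_congr_left fun q hq => ?_
      rw [Function.update_of_ne (by rintro rfl; exact hL.1 hq)]
    · intro k hk
      by_cases hkp : k = p
      · subst hkp; simp
      · simp [hkp, h k (by simp [hkp, hk])]
    · intro z hz
      by_contra hne
      exact hz (prod_bitButterfly_eq_zero L p hL.1 z x hne)

theorem prod_bitButterfly_ofFn {n : ℕ} (f : Fin n → Fin n) (hf : Function.Injective f)
    (y x : Fin n → ZMod 2) :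
    ((List.ofFn f).map bitButterfly).prod y x = bitSign (∑ k, y k * x k) := by
  have hb : Function.Bijective f := Finite.injective_iff_bijective.1 hf
  rw [prod_bitButterfly_apply _ (List.nodup_ofFn.2 hf), List.map_ofFn, List.prod_ofFn,
    bitSign_sum]
  · exact hb.prod_comp fun k => bitSign (y k * x k)
  · intro k hk
    exact absurd (List.mem_ofFn.2 (hb.2 k)) hk

theorem W_stepPerm_eq_hadamardH_iff (m : ℕ) (τ : ℕ → Equiv.Perm (Fin (m + 1))) :
    W (m + 1) (fun t => toMat (stepPerm τ t)) = hadamardH (m + 1) ↔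
      Function.Injective (fun k : Fin (m + 1) => τ k.val (Fin.last m)) ∧ τ (m + 1) = 1 := by
  rw [W_stepPerm, hadamardH_eq, EmbeddingLike.apply_eq_iff_eq, ← Matrix.ext_iff]
  simp only [mul_bitPerm_apply, Matrix.of_apply]
  constructor
  · intro h
    have hinj : Function.Injective (fun k : Fin (m + 1) => τ k.val (Fin.last m)) := by
      rw [Finite.injective_iff_surjective]
      intro q
      by_contra hq
      have := h (fun _ => 0) ((fun _ => 1) ∘ τ (m + 1))
      rw [prod_bitButterfly_eq_zero _ q (fun h' => hq (List.mem_ofFn.1 h')) _ _ (by simp)] at this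
      exact bitSign_ne_zero _ this.symm
    refine ⟨hinj, ?_⟩
    simp only [prod_bitButterfly_ofFn _ hinj] at h
    ext j : 1
    have := bitSign_injective (h (Pi.single (τ (m + 1) j) 1) (Pi.single j 1))
    by_contra hne
    simp [Pi.single_apply, Equiv.symm_apply_eq] at this
    exact hne this.symm
  · rintro ⟨hinj, h1⟩ y x
    rw [prod_bitButterfly_ofFn _ hinj, h1]
    rfl

theorem W_congr {n : ℕ} {P Q : ℕ → Matrix (Fin n) (Fin n) (ZMod 2)}
    (h : ∀ t ≤ n, P t = Q t) : W n P = W n Q := by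
  unfold W
  rw [h 0 (Nat.zero_le n)]
  congr 3
  ext k : 1
  rw [h (k.val + 1) k.isLt]

/-- Extension of a finite sequence of permutations by the identity. -/
def extendPerm {n r : ℕ} (τ : Fin r → Equiv.Perm (Fin n)) (t : ℕ) : Equiv.Perm (Fin n) :=
  if h : t < r then τ ⟨t, h⟩ else 1

theorem extendPerm_val {n r : ℕ} (τ : Fin r → Equiv.Perm (Fin n)) (k : Fin r) :
    extendPerm τ k = τ k :=
  dif_pos k.isLt

theorem stepPerm_eqOn {n : ℕ} {τ υ : ℕ → Equiv.Perm (Fin n)} {r : ℕ}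
    (h : ∀ t < r, stepPerm τ t = stepPerm υ t) : ∀ t < r, τ t = υ t := by
  intro t
  induction t with
  | zero => exact h 0
  | succ t ih =>
    intro ht
    have := h _ ht
    simpa [stepPerm, ih (by omega)] using this

theorem exists_stepPerm_eq {n : ℕ} (σ : ℕ → Equiv.Perm (Fin n)) : ∃ τ, stepPerm τ = σ := by
  refine ⟨fun t => Nat.rec (σ 0) (fun k g => g * σ (k + 1)) t, ?_⟩
  ext t : 1
  cases t <;> simp [stepPerm]

theorem card_sequences (m : ℕ) :
    Nat.card {P : Fin (m + 2) → Matrix (Fin (m + 1)) (Fin (m + 1)) (ZMod 2) //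
        (∀ k, IsPermMat (P k)) ∧
        W (m + 1) (fun t => if h : t < m + 2 then P ⟨t, h⟩ else 1) = hadamardH (m + 1)} =
      Nat.card {τ : Fin (m + 1) → Equiv.Perm (Fin (m + 1)) //
        Function.Injective fun k => τ k (Fin.last m)} := by
  symm
  have hW (P : Fin (m + 2) → Matrix (Fin (m + 1)) (Fin (m + 1)) (ZMod 2))
      (τ : ℕ → Equiv.Perm (Fin (m + 1))) (h : ∀ k : Fin (m + 2), P k = toMat (stepPerm τ k)) :
      W (m + 1) (fun t => if h : t < m + 2 then P ⟨t, h⟩ else 1) = hadamardH (m + 1) ↔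
        Function.Injective (fun k : Fin (m + 1) => τ k.val (Fin.last m)) ∧ τ (m + 1) = 1 := by
    rw [← W_stepPerm_eq_hadamardH_iff]
    rw [W_congr fun t ht => ?_]
    rw [dif_pos (Nat.lt_succ_of_le ht), h]
  refine Nat.card_congr (Equiv.ofBijective (fun τ => ⟨fun k => toMat (stepPerm (extendPerm τ.1) k),
    fun k => ⟨_, fun _ _ => rfl⟩, ?_⟩) ⟨?_, ?_⟩)
  · rw [hW _ _ fun _ => rfl]
    exact ⟨by simpa only [extendPerm_val] using τ.2, by simp [extendPerm]⟩
  · intro τ υ h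
    have h' := congrFun (Subtype.ext_iff.1 h)
    ext k : 2
    have := stepPerm_eqOn (r := m + 2) (fun t ht => toMat_injective (h' ⟨t, ht⟩)) k (by omega)
    simpa only [extendPerm_val] using this
  · rintro ⟨P, hP, hH⟩
    choose σ hσ using fun k => hP k
    obtain ⟨τ, hτ⟩ := exists_stepPerm_eq (extendPerm σ)
    have hPτ (k : Fin (m + 2)) : P k = toMat (stepPerm τ k) := by
      ext i j
      simp [hτ, hσ, toMat, extendPerm]
    obtain ⟨hinj, h1⟩ := (hW P τ hPτ).1 hH
    have hext (t : ℕ) (ht : t < m + 2) :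
        extendPerm (fun k : Fin (m + 1) => τ k) t = τ t := by
      rcases Nat.lt_succ_iff_lt_or_eq.1 ht with h | h
      · simp [extendPerm, h]
      · simp [extendPerm, h, h1]
    refine ⟨⟨fun k => τ k, hinj⟩, Subtype.ext (funext fun k => ?_)⟩
    refine Eq.trans (congrArg toMat ?_) (hPτ k).symm
    obtain ⟨k, hk⟩ := k
    cases k with
    | zero => simp only [stepPerm, hext _ hk]
    | succ k => simp only [stepPerm, hext _ hk, hext k (by omega)]

theorem card_perm_apply_eq (m : ℕ) (b a : Fin (m + 1)) :
    Nat.card {g : Equiv.Perm (Fin (m + 1)) // g b = a} = m.factorial := by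
  let e : {g : Equiv.Perm (Fin (m + 1)) // g b = a} ≃ Equiv.Perm (Fin m) :=
    { toFun g := (Equiv.Perm.decomposeFin (g.1 * Equiv.swap 0 b)).2
      invFun f := ⟨Equiv.Perm.decomposeFin.symm (a, f) * Equiv.swap 0 b, by simp⟩
      left_inv g := by
        obtain ⟨g, hg⟩ := g
        have h : (Equiv.Perm.decomposeFin (g * Equiv.swap 0 b)).1 = a := by
          have := Equiv.Perm.decomposeFin_symm_apply_zero
            (Equiv.Perm.decomposeFin (g * Equiv.swap 0 b)).1
            (Equiv.Perm.decomposeFin (g * Equiv.swap 0 b)).2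
          rw [Prod.mk.eta, Equiv.symm_apply_apply] at this
          rw [← this]
          simp [hg]
        apply Subtype.ext
        simp only [← h, Prod.mk.eta, Equiv.symm_apply_apply]
        simp [mul_assoc]
      right_inv f := by simp [mul_assoc] }
  rw [Nat.card_congr e, Nat.card_perm, Nat.card_fin]

theorem card_injective_orbits (m : ℕ) :
    Nat.card {τ : Fin (m + 1) → Equiv.Perm (Fin (m + 1)) //
        Function.Injective fun k => τ k (Fin.last m)} =
      (m + 1) * m.factorial ^ (m + 2) := by
  let e : {τ : Fin (m + 1) → Equiv.Perm (Fin (m + 1)) //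
        Function.Injective fun k => τ k (Fin.last m)} ≃
      Σ f : {f : Fin (m + 1) → Fin (m + 1) // Function.Injective f},
        ∀ k, {g : Equiv.Perm (Fin (m + 1)) // g (Fin.last m) = f.1 k} :=
    { toFun τ := ⟨⟨_, τ.2⟩, fun k => ⟨τ.1 k, rfl⟩⟩
      invFun x := ⟨fun k => (x.2 k).1, by simpa only [(x.2 _).2] using x.1.2⟩
      left_inv _ := rfl
      right_inv := by
        rintro ⟨⟨f, hf⟩, g⟩
        obtain ⟨g', hg', rfl⟩ : ∃ g' : Fin (m + 1) → Equiv.Perm (Fin (m + 1)),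
            ∃ hg' : ∀ k, g' k (Fin.last m) = f k, g = fun k => ⟨g' k, hg' k⟩ :=
          ⟨fun k => (g k).1, fun k => (g k).2, rfl⟩
        obtain rfl : (fun k => g' k (Fin.last m)) = f := funext hg'
        rfl }
  rw [Nat.card_congr e, Nat.card_sigma]
  simp only [Nat.card_pi, card_perm_apply_eq, Finset.prod_const, Finset.sum_const,
    Finset.card_univ, Fintype.card_fin, smul_eq_mul]
  rw [Fintype.card_congr (Equiv.subtypeInjectiveEquivEmbedding _ _), Fintype.card_embedding_eq]
  simp only [Fintype.card_fin, Nat.descFactorial_self, Nat.factorial_succ]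
  ring

end BitIndex

/-- The number of `DFT_2`-based bit-index-permuted fast WHT algorithms, i.e. sequences
of `n + 1` permutation matrices `P` with `W(P) = H_n`, is `n·((n−1)!)^{n+1}`
(here `n = m + 1`). -/
theorem count_bit_index_permuted (m : ℕ) :
    Nat.card {P : Fin (m + 2) → Matrix (Fin (m + 1)) (Fin (m + 1)) (ZMod 2) //
        (∀ k, IsPermMat (P k)) ∧
        W (m + 1) (fun t => if h : t < m + 2 then P ⟨t, h⟩ else 1) = hadamardH (m + 1)} =
      (m + 1) * (Nat.factorial m) ^ (m + 2) := by
  rw [card_sequences, card_injective_orbits]
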